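/- Let Ĝ^d be a swap-maximal loopy graph whose largest clique K^0 contained in V^0 has exactly d vertices, with d ≥ 3, and suppose every vertex of V^0 has degree at most that of every vertex not in V^0. If d = 3 then Ĝ^3 belongs to class Q2, and if d > 3 then Ĝ^d belongs to class Q1. -/

import Mathlib

open scoped Classical

/-- A loopy graph: at most one edge between any two distinct vertices and at most one
self-loop at each vertex, encoded as a symmetric adjacency relation. -/
structure LoopyGraph (V : Type) where
  Adj : V → V → Prop
  symm : ∀ u v : V, Adj u v → Adj v u

namespace LoopyGraph

variable {V : Type}

/-- The neighbors of `u` (vertices other than `u` adjacent to `u`). -/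
def nbr (G : LoopyGraph V) (u : V) : Set V := {v | v ≠ u ∧ G.Adj u v}

/-- Degree of a vertex: each self-loop contributes `2`. -/
noncomputable def deg (G : LoopyGraph V) (u : V) : ℕ :=
  (G.nbr u).ncard + (if G.Adj u u then 2 else 0)

/-- `G₂` is obtained from `G₁` by a single valid double edge swap
`(u,v),(x,y) ⤳ (u,x),(v,y)`: the two removed edges are distinct edges of `G₁`, the two
added edges are distinct and not already present (no multiedge and no doubled
self-loop is created). -/
def DoubleEdgeSwap (G₁ G₂ : LoopyGraph V) : Prop :=
  ∃ u v x y : V,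
    G₁.Adj u v ∧ G₁.Adj x y ∧
    s(u, v) ≠ s(x, y) ∧
    ¬ G₁.Adj u x ∧ ¬ G₁.Adj v y ∧ s(u, x) ≠ s(v, y) ∧
    ∀ a b : V, G₂.Adj a b ↔
      ((G₁.Adj a b ∧ s(a, b) ≠ s(u, v) ∧ s(a, b) ≠ s(x, y)) ∨
        s(a, b) = s(u, x) ∨ s(a, b) = s(v, y))

/-- `G₂` is reachable from `G₁` by a finite sequence of valid double edge swaps. -/
def Reach (G₁ G₂ : LoopyGraph V) : Prop :=
  Relation.ReflTransGen DoubleEdgeSwap G₁ G₂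

/-- Vertices at (shortest-path) distance at most `k` from the set of loop-free vertices. -/
def within (G : LoopyGraph V) : ℕ → Set V
  | 0 => {v | ¬ G.Adj v v}
  | (k + 1) => within G k ∪ {v | ∃ u ∈ within G k, G.Adj v u}

/-- `Vset G 0 = V^0` is the set of vertices with no self-loop; for `k ≥ 1`,
`Vset G k = V^k` is the set of vertices (necessarily carrying a self-loop) whose
shortest-path distance to `V^0` is exactly `k`. -/
def Vset (G : LoopyGraph V) : ℕ → Set V
  | 0 => {v | ¬ G.Adj v v}
  | (k + 1) => within G (k + 1) \ within G k

/-- `V^∞`: vertices (with a self-loop) having no path to `V^0`. -/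
def Vinf (G : LoopyGraph V) : Set V := {v | ∀ k : ℕ, v ∉ within G k}

/-- A set of vertices is a clique when all pairs of distinct members are adjacent. -/
def IsClique (G : LoopyGraph V) (s : Set V) : Prop :=
  ∀ x ∈ s, ∀ y ∈ s, x ≠ y → G.Adj x y

/-- The set of vertices carrying a self-loop. -/
def selfLoops (G : LoopyGraph V) : Set V := {v | G.Adj v v}

/-- The edges of `G` with both endpoints in `V^0`. -/
def V0edges (G : LoopyGraph V) : Set (Sym2 V) :=
  {e | ∃ u v : V, e = s(u, v) ∧ G.Adj u v ∧ u ∈ Vset G 0 ∧ v ∈ Vset G 0}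

/-- `Ĝ` is swap-maximal: among all loopy graphs reachable from it by double edge swaps it
has the maximum number of self-loops, and subject to that the maximum number of edges with
both endpoints in `V^0`. -/
def SwapMaximal (G : LoopyGraph V) : Prop :=
  ∀ H : LoopyGraph V, Reach G H →
    (selfLoops H).ncard ≤ (selfLoops G).ncard ∧
      ((selfLoops H).ncard = (selfLoops G).ncard →
        (V0edges H).ncard ≤ (V0edges G).ncard)

/-- `K` is a largest clique contained in `V^0`, and it has exactly `d` vertices. -/
def LargestV0Clique (G : LoopyGraph V) (K : Set V) (d : ℕ) : Prop :=
  K ⊆ Vset G 0 ∧ IsClique G K ∧ K.ncard = d ∧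
    ∀ K' : Set V, K' ⊆ Vset G 0 → IsClique G K' → K'.ncard ≤ d

/-- Class `Q1`. -/
def Q1 (G : LoopyGraph V) : Prop :=
  ∃ K : Set V, K ⊆ Vset G 0 ∧ 4 ≤ K.ncard ∧ IsClique G K ∧
    (∀ u ∈ Vset G 0, (∀ w ∈ Vset G 0, ¬ G.Adj u w) ∨ u ∈ K) ∧
    IsClique G (Vset G 1 ∪ K) ∧
    Vset G 2 = ∅ ∧ Vinf G = ∅

/-- Class `Q2`. -/
def Q2 (G : LoopyGraph V) : Prop :=
  3 ≤ {u | u ∈ Vset G 0 ∧ (nbr G u ∩ Vset G 0).ncard = 2}.ncard ∧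
  (∀ u ∈ Vset G 0,
      (∀ w ∈ Vset G 0, ¬ G.Adj u w) ∨
        ((nbr G u ∩ Vset G 0).ncard = 2 ∧ ∀ w ∈ Vset G 1, G.Adj u w)) ∧
  IsClique G (Vset G 1) ∧
  (∀ u ∈ Vset G 2, nbr G u = Vset G 1) ∧
  Vset G 3 = ∅ ∧
  (Vinf G = ∅ ∨ (Vset G 1 = ∅ ∧ ∀ u ∈ Vinf G, deg G u = 2))

/-- The graph of loopy graphs `𝒢({k_i})` is connected: any two loopy graphs with degree
sequence `k` are linked by a finite sequence of valid double edge swaps. -/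
def GConnected (k : V → ℕ) : Prop :=
  ∀ G₁ G₂ : LoopyGraph V, (∀ v, deg G₁ v = k v) → (∀ v, deg G₂ v = k v) →
    Reach G₁ G₂

/-- `G₂` is obtained from `G₁` by a single valid triangle-loop swap: either a triangle on
three distinct vertices is replaced by three self-loops, or conversely. -/
def TriangleLoopSwap (G₁ G₂ : LoopyGraph V) : Prop :=
  ∃ u v w : V, u ≠ v ∧ v ≠ w ∧ u ≠ w ∧
    ((G₁.Adj u v ∧ G₁.Adj v w ∧ G₁.Adj w u ∧
        ¬ G₁.Adj u u ∧ ¬ G₁.Adj v v ∧ ¬ G₁.Adj w w ∧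
        ∀ a b : V, G₂.Adj a b ↔
          ((G₁.Adj a b ∧ s(a, b) ≠ s(u, v) ∧ s(a, b) ≠ s(v, w) ∧ s(a, b) ≠ s(w, u)) ∨
            s(a, b) = s(u, u) ∨ s(a, b) = s(v, v) ∨ s(a, b) = s(w, w))) ∨
      (G₁.Adj u u ∧ G₁.Adj v v ∧ G₁.Adj w w ∧
        ¬ G₁.Adj u v ∧ ¬ G₁.Adj v w ∧ ¬ G₁.Adj w u ∧
        ∀ a b : V, G₂.Adj a b ↔
          ((G₁.Adj a b ∧ s(a, b) ≠ s(u, u) ∧ s(a, b) ≠ s(v, v) ∧ s(a, b) ≠ s(w, w)) ∨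
            s(a, b) = s(u, v) ∨ s(a, b) = s(v, w) ∨ s(a, b) = s(w, u))))

/-- Reachability in the augmented graph of loopy graphs `𝒢_△`: a finite sequence of moves,
each a valid double edge swap or a valid triangle-loop swap. -/
def ReachTri (G₁ G₂ : LoopyGraph V) : Prop :=
  Relation.ReflTransGen
    (fun H₁ H₂ => DoubleEdgeSwap H₁ H₂ ∨ TriangleLoopSwap H₁ H₂) G₁ G₂

/-- `S` is a set of highest-degree vertices for the degree sequence `k`. -/
def TopSet (k : V → ℕ) (S : Set V) : Prop :=
  ∀ u ∈ S, ∀ v : V, v ∉ S → k v ≤ k u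

/-- A loopy graph is simple when it has no self-loops. -/
def IsSimple (G : LoopyGraph V) : Prop := ∀ v : V, ¬ G.Adj v v

/-- `k` is the degree sequence of some simple graph. -/
def SimpleGraphical (k : V → ℕ) : Prop :=
  ∃ G : LoopyGraph V, IsSimple G ∧ ∀ v, deg G v = k v

/-- `k` is `m`-simple-graphical: subtracting `2` from each of the `m` largest entries
yields a simple-graphical sequence. -/
def MSimpleGraphical (k : V → ℕ) (m : ℕ) : Prop :=
  ∃ S : Set V, S.ncard = m ∧ TopSet k S ∧ (∀ v ∈ S, 2 ≤ k v) ∧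
    SimpleGraphical (fun v : V => if v ∈ S then k v - 2 else k v)

/-- `m` is `m*`, the maximum `m` for which the sequence is `m`-simple-graphical. -/
def IsMStar (k : V → ℕ) (m : ℕ) : Prop :=
  MSimpleGraphical k m ∧ ∀ m' : ℕ, MSimpleGraphical k m' → m' ≤ m

/-- `G` is `m`-loopy: it has self-loops exactly at `m` highest-degree vertices. -/
def MLoopy (G : LoopyGraph V) (m : ℕ) : Prop :=
  (selfLoops G).ncard = m ∧ TopSet (deg G) (selfLoops G)

end LoopyGraph

namespace LoopyGraph

variable {V : Type} {G : LoopyGraph V}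

/-- The result of replacing the edges `(u,v)`, `(x,y)` by `(u,x)`, `(v,y)`. -/
def swap (G : LoopyGraph V) (u v x y : V) : LoopyGraph V where
  Adj a b := (G.Adj a b ∧ s(a, b) ≠ s(u, v) ∧ s(a, b) ≠ s(x, y)) ∨
    s(a, b) = s(u, x) ∨ s(a, b) = s(v, y)
  symm a b h := by
    rw [Sym2.eq_swap (a := b)]
    exact h.imp_left fun h' => ⟨G.symm _ _ h'.1, h'.2⟩

theorem swap_adj (G : LoopyGraph V) (u v x y a b : V) :
    (G.swap u v x y).Adj a b ↔
      ((G.Adj a b ∧ s(a, b) ≠ s(u, v) ∧ s(a, b) ≠ s(x, y)) ∨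
        s(a, b) = s(u, x) ∨ s(a, b) = s(v, y)) := Iff.rfl

theorem doubleEdgeSwap_swap {u v x y : V} (h₁ : G.Adj u v) (h₂ : G.Adj x y)
    (h₃ : s(u, v) ≠ s(x, y)) (h₄ : ¬ G.Adj u x) (h₅ : ¬ G.Adj v y)
    (h₆ : s(u, x) ≠ s(v, y)) : DoubleEdgeSwap G (G.swap u v x y) :=
  ⟨u, v, x, y, h₁, h₂, h₃, h₄, h₅, h₆, fun _ _ => Iff.rfl⟩

theorem SwapMaximal.adj_self [Finite V] (hmax : G.SwapMaximal) {H : LoopyGraph V}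
    (hr : Reach G H) (hle : ∀ v, G.Adj v v → H.Adj v v) {a : V} (ha : H.Adj a a) :
    G.Adj a a := by
  by_contra hn
  have hlt : (selfLoops G).ncard < (selfLoops H).ncard :=
    Set.ncard_lt_ncard ⟨hle, fun h => hn (h ha)⟩
  exact absurd (hmax H hr).1 hlt.not_ge

theorem SwapMaximal.adj_of_adj_of_adj [Finite V] (hmax : G.SwapMaximal) {u v y : V}
    (hu : ¬ G.Adj u u) (hv : G.Adj u v) (hy : G.Adj u y) (hvy : v ≠ y) : G.Adj v y := by
  by_contra hn
  have huv : u ≠ v := by rintro rfl; exact hu hv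
  have huy : u ≠ y := by rintro rfl; exact hu hy
  have hs : DoubleEdgeSwap G (G.swap u v u y) :=
    doubleEdgeSwap_swap hv hy (by grind [Sym2.eq_iff]) hu hn (by simp [huy])
  refine hu (hmax.adj_self (.single hs) (fun z hz => ?_) (a := u) ?_)
  · rw [swap_adj]
    exact .inl ⟨hz, by grind [Sym2.eq_iff], by grind [Sym2.eq_iff]⟩
  · simp [swap_adj]

/-- Two disjoint loop-free edges with no edges between them, one of which lies in a triangle whose
apex is not adjacent to the other edge, allow the creation of a self-loop. -/
theorem SwapMaximal.not_triangle_and_edge [Finite V] (hmax : G.SwapMaximal) {a b c x y : V}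
    (ha : ¬ G.Adj a a) (hx : ¬ G.Adj x x) (hab : G.Adj a b)
    (hac : G.Adj a c) (hbc : b ≠ c) (hxy : G.Adj x y)
    (hax : ¬ G.Adj a x) (hby : ¬ G.Adj b y) (hcx : ¬ G.Adj c x)
    (hxne : x ≠ a ∧ x ≠ b ∧ x ≠ c) (hyne : y ≠ a ∧ y ≠ b ∧ y ≠ c) : False := by
  have hab' : a ≠ b := by rintro rfl; exact ha hab
  have hac' : a ≠ c := by rintro rfl; exact ha hac
  have hxy' : x ≠ y := by rintro rfl; exact hx hxy
  have hs₁ : DoubleEdgeSwap G (G.swap a b x y) :=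
    doubleEdgeSwap_swap hab hxy (by grind [Sym2.eq_iff]) hax hby (by grind [Sym2.eq_iff])
  have hs₂ : DoubleEdgeSwap (G.swap a b x y) ((G.swap a b x y).swap a c a x) := by
    apply doubleEdgeSwap_swap <;> grind [Sym2.eq_iff, swap_adj]
  refine ha (hmax.adj_self (.tail (.single hs₁) hs₂) (fun z hz => ?_) (a := a) ?_)
  · grind [Sym2.eq_iff, swap_adj]
  · simp [swap_adj]

/-- A looped vertex `w` with a neighbor `u` cannot be far from a loop-free triangle. -/
theorem SwapMaximal.not_triangle_and_looped [Finite V] (hmax : G.SwapMaximal) {a b c w u : V}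
    (ha : ¬ G.Adj a a) (hab : G.Adj a b) (hac : G.Adj a c) (hbc : b ≠ c)
    (hw : G.Adj w w) (hwu : G.Adj w u) (hne : u ≠ w)
    (hwa : ¬ G.Adj w a) (hwb : ¬ G.Adj w b) (hwc : ¬ G.Adj w c) (hub : ¬ G.Adj u b)
    (hb : ¬ G.Adj b b) : False := by
  have hab' : a ≠ b := by rintro rfl; exact ha hab
  have hac' : a ≠ c := by rintro rfl; exact ha hac
  have hwa' : w ≠ a := by rintro rfl; exact hwa hw
  have hwb' : w ≠ b := by rintro rfl; exact hwb hw
  have hwc' : w ≠ c := by rintro rfl; exact hwc hw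
  have hua' : u ≠ a := by rintro rfl; exact hwa hwu
  have hub' : u ≠ b := by rintro rfl; exact hwb hwu
  have huc' : u ≠ c := by rintro rfl; exact hwc hwu
  have hcw : ¬ G.Adj c w := fun h => hwc (G.symm _ _ h)
  set G₁ := G.swap w w a b with hG₁
  set G₂ := G₁.swap a c a w with hG₂
  have hs₁ : DoubleEdgeSwap G G₁ :=
    doubleEdgeSwap_swap hw hab (by grind [Sym2.eq_iff]) hwa hwb (by grind [Sym2.eq_iff])
  have hs₂ : DoubleEdgeSwap G₁ G₂ := by
    apply doubleEdgeSwap_swap <;> grind [Sym2.eq_iff, swap_adj]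
  have hs₃ : DoubleEdgeSwap G₂ (G₂.swap w u w b) := by
    apply doubleEdgeSwap_swap <;> grind [Sym2.eq_iff, swap_adj]
  refine ha (hmax.adj_self (.tail (.tail (.single hs₁) hs₂) hs₃) (fun z hz => ?_) (a := a) ?_) <;>
    grind [Sym2.eq_iff, swap_adj]

theorem mem_Vset_one {w : V} :
    w ∈ Vset G 1 ↔ G.Adj w w ∧ ∃ u, ¬ G.Adj u u ∧ G.Adj w u := by
  simp only [Vset, within, Set.mem_sdiff, Set.mem_union, Set.mem_ofPred_eq]
  tauto

section LargestClique

variable [Finite V] {K : Set V} {d : ℕ}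

theorem LargestV0Clique.mem_of_adj (hK : LargestV0Clique G K d) (hmax : G.SwapMaximal)
    {u a : V} (hu : ¬ G.Adj u u) (ha : a ∈ K) (hua : G.Adj u a) : u ∈ K := by
  by_contra hn
  obtain ⟨h0, hc, hcard, hlarge⟩ := hK
  have hadj : ∀ b ∈ K, G.Adj u b := fun b hb => by
    by_cases hab : a = b
    · exact hab ▸ hua
    · exact hmax.adj_of_adj_of_adj (h0 ha) (G.symm _ _ hua) (hc a ha b hb hab)
        (fun h => hn (h ▸ hb))
  have := hlarge (insert u K) (Set.insert_subset hu h0) (by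
    rintro x (rfl | hx) y (rfl | hy) hxy
    · exact absurd rfl hxy
    · exact hadj y hy
    · exact G.symm _ _ (hadj x hx)
    · exact hc x hx y hy hxy)
  rw [Set.ncard_insert_of_notMem hn] at this
  omega

/-- Every edge inside `V^0` lies in the largest clique. -/
theorem LargestV0Clique.mem_of_adj_V0 (hK : LargestV0Clique G K d) (hmax : G.SwapMaximal)
    (hd : 3 ≤ d) {x y : V} (hx : ¬ G.Adj x x) (hy : ¬ G.Adj y y) (hxy : G.Adj x y) :
    x ∈ K := by
  by_contra hxK
  have hyK : y ∉ K := fun h => hxK (hK.mem_of_adj hmax hx h hxy)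
  obtain ⟨a, b, c, ha, hb, hc, hab, hac, hbc⟩ :=
    (Set.two_lt_ncard_iff (s := K)).1 (by rw [hK.2.2.1]; omega)
  have hnx : ∀ k ∈ K, ¬ G.Adj k x := fun k hk h => hxK (hK.mem_of_adj hmax hx hk (G.symm _ _ h))
  have hny : ∀ k ∈ K, ¬ G.Adj k y := fun k hk h => hyK (hK.mem_of_adj hmax hy hk (G.symm _ _ h))
  exact hmax.not_triangle_and_edge (hK.1 ha) hx (hK.2.1 a ha b hb hab) (hK.2.1 a ha c hc hac) hbc
    hxy (hnx a ha) (hny b hb) (hnx c hc) (by grind) (by grind)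

/-- A looped vertex not adjacent to the clique only has neighbors adjacent to the whole clique. -/
theorem LargestV0Clique.adj_of_adj_looped (hK : LargestV0Clique G K d) (hmax : G.SwapMaximal)
    (hd : 3 ≤ d) {w u : V} (hw : G.Adj w w) (hwK : ∀ k ∈ K, ¬ G.Adj w k)
    (hwu : G.Adj w u) (hne : u ≠ w) {k : V} (hk : k ∈ K) : G.Adj u k := by
  by_contra hn
  obtain ⟨a, c, ha, hc, hka, hkc, hac⟩ : ∃ a c, a ∈ K ∧ c ∈ K ∧ k ≠ a ∧ k ≠ c ∧ a ≠ c := by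
    obtain ⟨a, c, ha, hc, hac⟩ := (Set.one_lt_ncard_iff (s := K \ {k})).1 (by
      rw [Set.ncard_sdiff_singleton_of_mem hk, hK.2.2.1]; omega)
    exact ⟨a, c, ha.1, hc.1, Ne.symm ha.2, Ne.symm hc.2, hac⟩
  exact hmax.not_triangle_and_looped (hK.1 ha) (hK.2.1 a ha k hk hka.symm)
    (hK.2.1 a ha c hc hac) hkc hw hwu hne (hwK a ha) (hwK k hk) (hwK c hc) hn (hK.1 hk)

theorem LargestV0Clique.adj_of_mem_Vset_one (hK : LargestV0Clique G K d) (hmax : G.SwapMaximal)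
    (hd : 3 ≤ d) {w k : V} (hw : w ∈ Vset G 1) (hk : k ∈ K) : G.Adj w k := by
  obtain ⟨hww, u, hu, hwu⟩ := mem_Vset_one.1 hw
  by_cases h : ∃ a ∈ K, G.Adj w a
  · obtain ⟨a, ha, hwa⟩ := h
    by_cases hak : a = k
    · exact hak ▸ hwa
    · exact hmax.adj_of_adj_of_adj (hK.1 ha) (G.symm _ _ hwa) (hK.2.1 a ha k hk hak)
        (fun h => hK.1 hk (h ▸ hww))
  · push Not at h
    have huk := hK.adj_of_adj_looped hmax hd hww h hwu (fun h => hu (h ▸ hww)) hk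
    exact absurd hwu (h u (hK.mem_of_adj hmax hu hk huk))

theorem LargestV0Clique.isClique_Vset_one_union (hK : LargestV0Clique G K d)
    (hmax : G.SwapMaximal) (hd : 3 ≤ d) : IsClique G (Vset G 1 ∪ K) := by
  obtain ⟨a, ha⟩ : K.Nonempty := Set.nonempty_of_ncard_ne_zero (by rw [hK.2.2.1]; omega)
  have h1 := fun {w k : V} => hK.adj_of_mem_Vset_one hmax hd (w := w) (k := k)
  rintro x (hx | hx) y (hy | hy) hxy
  · exact hmax.adj_of_adj_of_adj (hK.1 ha) (G.symm _ _ (h1 hx ha)) (G.symm _ _ (h1 hy ha)) hxy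
  · exact h1 hx hy
  · exact G.symm _ _ (h1 hy hx)
  · exact hK.2.1 x hx y hy hxy

/-- A looped vertex outside `V^1` has all its neighbors in `V^1`. -/
theorem LargestV0Clique.nbr_subset_Vset_one (hK : LargestV0Clique G K d)
    (hmax : G.SwapMaximal) (hd : 3 ≤ d) {w : V} (hw : G.Adj w w) (hw1 : w ∉ Vset G 1) :
    nbr G w ⊆ Vset G 1 := by
  rintro u ⟨hne, hwu⟩
  obtain ⟨a, ha⟩ : K.Nonempty := Set.nonempty_of_ncard_ne_zero (by rw [hK.2.2.1]; omega)
  have hn : ∀ k, ¬ G.Adj k k → ¬ G.Adj w k := fun k hk h => hw1 (mem_Vset_one.2 ⟨hw, k, hk, h⟩)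
  have hua := hK.adj_of_adj_looped hmax hd hw (fun k hk => hn k (hK.1 hk)) hwu hne ha
  exact mem_Vset_one.2 ⟨by_contra fun h => hn u h hwu, a, hK.1 ha, hua⟩

theorem LargestV0Clique.le_deg (hK : LargestV0Clique G K d) (hmax : G.SwapMaximal)
    (hd : 3 ≤ d) {a : V} (ha : a ∈ K) : d - 1 + (Vset G 1).ncard ≤ G.deg a := by
  have hdisj : Disjoint (K \ {a}) (Vset G 1) :=
    Set.disjoint_left.2 fun x hx hx1 => hK.1 hx.1 (mem_Vset_one.1 hx1).1
  have hsub : (K \ {a}) ∪ Vset G 1 ⊆ nbr G a := by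
    rintro x (hx | hx)
    · exact ⟨hx.2, hK.2.1 a ha x hx.1 (Ne.symm hx.2)⟩
    · exact ⟨fun h => hK.1 ha (h ▸ (mem_Vset_one.1 hx).1),
        G.symm _ _ (hK.adj_of_mem_Vset_one hmax hd hx ha)⟩
  have h := Set.ncard_le_ncard hsub
  rw [Set.ncard_union_eq hdisj, Set.ncard_sdiff_singleton_of_mem ha, hK.2.2.1] at h
  exact h.trans (Nat.le_add_right _ _)

/-- A looped vertex outside `V^1` whose degree is at least those of the vertices of `V^0` forces
the clique to be a triangle, and it is adjacent to the whole of `V^1`. -/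
theorem LargestV0Clique.eq_three_and_nbr_eq (hK : LargestV0Clique G K d)
    (hmax : G.SwapMaximal) (hd : 3 ≤ d) {w : V} (hw : G.Adj w w) (hw1 : w ∉ Vset G 1)
    (hdc : ∀ u ∈ Vset G 0, G.deg u ≤ G.deg w) : d = 3 ∧ nbr G w = Vset G 1 := by
  obtain ⟨a, ha⟩ : K.Nonempty := Set.nonempty_of_ncard_ne_zero (by rw [hK.2.2.1]; omega)
  have hsub := hK.nbr_subset_Vset_one hmax hd hw hw1
  have hle := Set.ncard_le_ncard hsub
  have hdeg := (hK.le_deg hmax hd ha).trans (hdc a (hK.1 ha))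
  rw [deg, if_pos hw] at hdeg
  exact ⟨by omega, Set.eq_of_subset_of_ncard_le hsub (by omega)⟩

theorem LargestV0Clique.nbr_inter_V0 (hK : LargestV0Clique G K d) (hmax : G.SwapMaximal)
    {a : V} (ha : a ∈ K) : (nbr G a ∩ Vset G 0).ncard = d - 1 := by
  have : nbr G a ∩ Vset G 0 = K \ {a} := by
    ext x
    constructor
    · rintro ⟨⟨hne, hax⟩, hx⟩
      exact ⟨hK.mem_of_adj hmax hx ha (G.symm _ _ hax), hne⟩
    · rintro ⟨hx, hne⟩
      exact ⟨⟨hne, hK.2.1 a ha x hx (Ne.symm hne)⟩, hK.1 hx⟩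
  rw [this, Set.ncard_sdiff_singleton_of_mem ha, hK.2.2.1]

end LargestClique

theorem adj_self_of_notMem_within {k : ℕ} {w : V} (hw : w ∉ within G k) : G.Adj w w := by
  induction k with
  | zero => exact not_not.1 hw
  | succ k ih => exact ih fun h => hw (.inl h)

end LoopyGraph

/-- A swap-maximal loopy graph `Ĝ^d` with `d ≥ 3` in which every vertex of
`V^0` has degree at most that of every vertex not in `V^0` belongs to class `Q2` if
`d = 3` and to class `Q1` if `d > 3`. -/
theorem Ghat_d_in_Q1_or_Q2 {V : Type} [Fintype V] (G : LoopyGraph V)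
    (hmax : G.SwapMaximal) (K : Set V) (d : ℕ) (hd : 3 ≤ d)
    (hK : LoopyGraph.LargestV0Clique G K d)
    (hdc : ∀ u ∈ LoopyGraph.Vset G 0, ∀ x : V, x ∉ LoopyGraph.Vset G 0 →
      G.deg u ≤ G.deg x) :
    (d = 3 → G.Q2) ∧ (3 < d → G.Q1) := by
  have hcl := hK.isClique_Vset_one_union hmax hd
  have hV0 : ∀ u ∈ G.Vset 0, (∀ w ∈ G.Vset 0, ¬ G.Adj u w) ∨ u ∈ K := fun u hu => by
    by_contra! h
    obtain ⟨⟨w, hw, huw⟩, hn⟩ := h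
    exact hn (hK.mem_of_adj_V0 hmax hd hu hw huw)
  have hfar : ∀ w, G.Adj w w → w ∉ G.Vset 1 → d = 3 ∧ G.nbr w = G.Vset 1 := fun w hw hw1 =>
    hK.eq_three_and_nbr_eq hmax hd hw hw1 fun u hu => hdc u hu w (not_not.2 hw)
  have hfar2 : ∀ w ∈ G.Vset 2, d = 3 ∧ G.nbr w = G.Vset 1 := fun w hw =>
    hfar w (LoopyGraph.adj_self_of_notMem_within hw.2) fun h => hw.2 h.1
  have hfarInf : ∀ w ∈ G.Vinf, d = 3 ∧ G.nbr w = G.Vset 1 := fun w hw =>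
    hfar w (LoopyGraph.adj_self_of_notMem_within (hw 0)) fun h => hw 1 h.1
  refine ⟨?_, fun h3 => ⟨K, hK.1, by rw [hK.2.2.1]; omega, hK.2.1, hV0, hcl, ?_, ?_⟩⟩
  · rintro rfl
    refine ⟨?_, fun u hu => (hV0 u hu).imp_right fun h =>
        ⟨hK.nbr_inter_V0 hmax h, fun w hw => hcl u (.inr h) w (.inl hw) ?_⟩,
      fun x hx y hy => hcl x (.inl hx) y (.inl hy), fun u hu => (hfar2 u hu).2, ?_, ?_⟩
    · rw [← hK.2.2.1]
      exact Set.ncard_le_ncard fun u hu => ⟨hK.1 hu, hK.nbr_inter_V0 hmax hu⟩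
    · rintro rfl
      exact hu (LoopyGraph.mem_Vset_one.1 hw).1
    · refine Set.eq_empty_of_forall_notMem fun w hw => ?_
      have hww := LoopyGraph.adj_self_of_notMem_within hw.2
      obtain ⟨hw' | ⟨u, hu, hwu⟩, hn⟩ := hw
      · exact hn hw'
      · have hu1 : u ∉ G.within 1 := fun h => hn (.inr ⟨u, h, hwu⟩)
        have hne : u ≠ w := fun h => hn (h ▸ hu)
        have hw1 : w ∉ G.Vset 1 := fun h => hn (.inl h.1)
        exact hu1 (hK.nbr_subset_Vset_one hmax hd hww hw1 ⟨hne, hwu⟩).1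
    · rcases Set.eq_empty_or_nonempty G.Vinf with h | ⟨w, hw⟩
      · exact .inl h
      have hV1 : G.Vset 1 = ∅ := Set.eq_empty_of_forall_notMem fun u hu => by
        have huw : u ∈ G.nbr w := (hfarInf w hw).2 ▸ hu
        exact hw 2 (.inr ⟨u, hu.1, huw.2⟩)
      refine .inr ⟨hV1, fun u hu => ?_⟩
      rw [LoopyGraph.deg, (hfarInf u hu).2, hV1, Set.ncard_empty,
        if_pos (LoopyGraph.adj_self_of_notMem_within (hu 0))]
  · exact Set.eq_empty_of_forall_notMem fun w hw => h3.ne' (hfar2 w hw).1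
  · exact Set.eq_empty_of_forall_notMem fun w hw => h3.ne' (hfarInf w hw).1
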